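/- Let f be a finite nonnegative Borel measure on ℝ and let 0 < t₁ ≤ t₂. Then limsup_{N→∞} (N/log N) · V_N ≤ 2 t₁ · f(ℝ), where V_N := N^{−2} ∫_{[0,N]²} ∫_0^{t₁} ∫_ℝ p_{2s(τ−s)/τ}((s/τ)(τ₂x₂ − τ₁x₁) − y) f(dy) ds dx₁ dx₂. -/

import Mathlib

open MeasureTheory

/-- One-dimensional heat kernel `p_t(x) = (2πt)^{-1/2} exp(-x²/(2t))`. -/
noncomputable def heat1 (t x : ℝ) : ℝ :=
  (2 * Real.pi * t) ^ (-(1 : ℝ) / 2) * Real.exp (-x ^ 2 / (2 * t))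

/-- `V_N = N⁻² ∫_{[0,N]²} ∫_0^{t₁} ∫_ℝ p_{2s(τ-s)/τ}((s/τ)(τ₂x₂ - τ₁x₁) - y) f(dy) ds dx₁ dx₂`
with `τ = 2t₁t₂/(t₁+t₂)`, `τ₁ = 2t₂/(t₁+t₂)`, `τ₂ = 2t₁/(t₁+t₂)`. -/
noncomputable def VN (f : Measure ℝ) (t₁ t₂ N : ℝ) : ℝ :=
  let τ := 2 * t₁ * t₂ / (t₁ + t₂)
  let τ₁ := 2 * t₂ / (t₁ + t₂)
  let τ₂ := 2 * t₁ / (t₁ + t₂)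
  (N ^ 2)⁻¹ * ∫ x₁ in Set.Icc (0 : ℝ) N, ∫ x₂ in Set.Icc (0 : ℝ) N,
    ∫ s in Set.Ioo (0 : ℝ) t₁,
      ∫ y, heat1 (2 * s * (τ - s) / τ) ((s / τ) * (τ₂ * x₂ - τ₁ * x₁) - y) ∂f

open ProbabilityTheory Filter Set

theorem lintegral_lintegral_lintegral_lintegral_swap
    {α β γ δ : Type*} [MeasurableSpace α] [MeasurableSpace β] [MeasurableSpace γ]
    [MeasurableSpace δ] (μ : Measure α) (ν : Measure β) (ρ : Measure γ) (κ : Measure δ)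
    [SFinite μ] [SFinite ν] [SFinite ρ] [SFinite κ] (F : α → β → γ → δ → ENNReal)
    (hF : Measurable fun p : α × β × γ × δ => F p.1 p.2.1 p.2.2.1 p.2.2.2) :
    ∫⁻ x, ∫⁻ y, ∫⁻ s, ∫⁻ z, F x y s z ∂κ ∂ρ ∂ν ∂μ =
      ∫⁻ s, ∫⁻ z, ∫⁻ y, ∫⁻ x, F x y s z ∂μ ∂ν ∂κ ∂ρ := by
  have h (x : α) : ∫⁻ y, ∫⁻ s, ∫⁻ z, F x y s z ∂κ ∂ρ ∂ν =
      ∫⁻ s, ∫⁻ z, ∫⁻ y, F x y s z ∂ν ∂κ ∂ρ := by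
    rw [lintegral_lintegral_swap]
    · refine lintegral_congr fun s => lintegral_lintegral_swap ?_
      exact (hF.comp (by fun_prop :
        Measurable fun p : β × δ => (x, p.1, s, p.2))).aemeasurable
    · refine Measurable.aemeasurable ?_
      refine Measurable.lintegral_prod_right' (f := fun q : (β × γ) × δ => F x q.1.1 q.1.2 q.2) ?_
      exact hF.comp (by fun_prop : Measurable fun q : (β × γ) × δ => (x, q.1.1, q.1.2, q.2))
  simp_rw [h]
  have hG : Measurable fun q : (α × γ) × δ => ∫⁻ y, F q.1.1 y q.1.2 q.2 ∂ν := by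
    refine Measurable.lintegral_prod_right'
      (f := fun q : ((α × γ) × δ) × β => F q.1.1.1 q.2 q.1.1.2 q.1.2) ?_
    exact hF.comp (by fun_prop :
      Measurable fun q : ((α × γ) × δ) × β => (q.1.1.1, q.2, q.1.1.2, q.1.2))
  rw [lintegral_lintegral_swap]
  · refine lintegral_congr fun s => ?_
    rw [lintegral_lintegral_swap]
    · refine lintegral_congr fun z => lintegral_lintegral_swap ?_
      exact (hF.comp (by fun_prop :
        Measurable fun p : α × β => (p.1, p.2, s, z))).aemeasurable
    · exact (hG.comp (by fun_prop : Measurable fun p : α × δ => ((p.1, s), p.2))).aemeasurable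
  · exact (Measurable.lintegral_prod_right' hG).aemeasurable

theorem heat1_nonneg {t : ℝ} (ht : 0 ≤ t) (x : ℝ) : 0 ≤ heat1 t x := by
  unfold heat1; positivity

theorem heat1_le {t r : ℝ} (hr : 0 < r) (hrt : r ≤ t) (x : ℝ) :
    heat1 t x ≤ r ^ (-(1 : ℝ) / 2) := by
  unfold heat1
  have hexp : Real.exp (-x ^ 2 / (2 * t)) ≤ 1 := by
    rw [Real.exp_le_one_iff]
    exact div_nonpos_of_nonpos_of_nonneg (by nlinarith [sq_nonneg x]) (by linarith)
  have hle : r ≤ 2 * Real.pi * t := by nlinarith [Real.pi_gt_three]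
  calc _ ≤ (2 * Real.pi * t) ^ (-(1 : ℝ) / 2) * 1 := by
        gcongr
        have : 0 < 2 * Real.pi * t := hr.trans_le hle
        positivity
    _ ≤ _ := by
        rw [mul_one]
        exact Real.rpow_le_rpow_of_nonpos hr hle (by norm_num)

theorem heat1_affine {t b : ℝ} (ht : 0 < t) (hb : 0 < b) (c x : ℝ) :
    heat1 t (c - b * x) = b⁻¹ * gaussianPDFReal (c / b) (t / b ^ 2).toNNReal x := by
  have hv : 0 ≤ t / b ^ 2 := by positivity
  rw [heat1, gaussianPDFReal, Real.coe_toNNReal _ hv, ← mul_assoc]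
  congr 1
  · rw [show 2 * Real.pi * (t / b ^ 2) = (2 * Real.pi * t) / b ^ 2 by ring,
      Real.sqrt_div (by positivity), Real.sqrt_sq hb.le, neg_div,
      Real.rpow_neg (by positivity), ← Real.sqrt_eq_rpow]
    field_simp
  · congr 1
    field_simp
    ring

theorem lintegral_enorm_heat1_affine {t b : ℝ} (ht : 0 < t) (hb : 0 < b) (c : ℝ) :
    ∫⁻ x, ‖heat1 t (c - b * x)‖ₑ = ENNReal.ofReal b⁻¹ := by
  have hv : (t / b ^ 2).toNNReal ≠ 0 := by
    have : 0 < t / b ^ 2 := by positivity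
    simpa using this
  have h (x : ℝ) : ‖heat1 t (c - b * x)‖ₑ =
      ENNReal.ofReal b⁻¹ * ENNReal.ofReal (gaussianPDFReal (c / b) (t / b ^ 2).toNNReal x) := by
    rw [Real.enorm_of_nonneg (heat1_nonneg ht.le _), heat1_affine ht hb,
      ENNReal.ofReal_mul (by positivity)]
  simp_rw [h]
  rw [lintegral_const_mul _ (by fun_prop), lintegral_gaussianPDFReal_eq_one _ hv, mul_one]

theorem setLIntegral_rpow_neg_half {ε : ℝ} (hε : 0 < ε) :
    ∫⁻ s in Ioc 0 ε, ENNReal.ofReal (s ^ (-(1 : ℝ) / 2)) = ENNReal.ofReal (2 * √ε) := by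
  have hint : IntervalIntegrable (fun s : ℝ => s ^ (-(1 : ℝ) / 2)) volume 0 ε :=
    intervalIntegral.intervalIntegrable_rpow' (by norm_num)
  rw [← ofReal_integral_eq_lintegral_ofReal
    ((intervalIntegrable_iff_integrableOn_Ioc_of_le hε.le).1 hint)
    (ae_restrict_of_forall_mem measurableSet_Ioc fun s hs => by
      have := hs.1; simp only [Pi.zero_apply]; positivity),
    ← intervalIntegral.integral_of_le hε.le, integral_rpow (by norm_num),
    Real.sqrt_eq_rpow]
  congr 1
  norm_num
  ring

theorem setLIntegral_inv {ε t : ℝ} (hε : 0 < ε) (ht : ε ≤ t) :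
    ∫⁻ s in Ioc ε t, ENNReal.ofReal s⁻¹ = ENNReal.ofReal (Real.log (t / ε)) := by
  have h0 : (0 : ℝ) ∉ uIcc ε t := by
    rw [uIcc_of_le ht]; exact fun h => absurd h.1 (not_le.2 hε)
  have hint : IntervalIntegrable (fun s : ℝ => s⁻¹) volume ε t :=
    intervalIntegral.intervalIntegrable_inv (fun x hx hx0 => h0 (hx0 ▸ hx)) continuousOn_id
  rw [← ofReal_integral_eq_lintegral_ofReal
    ((intervalIntegrable_iff_integrableOn_Ioc_of_le ht).1 hint)
    (ae_restrict_of_forall_mem measurableSet_Ioc fun s hs => by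
      have := hε.trans hs.1; simp only [Pi.zero_apply]; positivity),
    ← intervalIntegral.integral_of_le ht, integral_inv h0]

theorem VN_nonneg (f : Measure ℝ) {t₁ t₂ : ℝ} (h1 : 0 < t₁) (h12 : t₁ ≤ t₂) (N : ℝ) :
    0 ≤ VN f t₁ t₂ N := by
  have hτ : t₁ ≤ 2 * t₁ * t₂ / (t₁ + t₂) := by
    rw [le_div_iff₀ (by linarith)]; nlinarith
  refine mul_nonneg (by positivity) ?_
  refine integral_nonneg fun x₁ => integral_nonneg fun x₂ => ?_
  refine setIntegral_nonneg measurableSet_Ioo fun s hs => integral_nonneg fun y => ?_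
  refine heat1_nonneg ?_ _
  have := hs.1
  have := hs.2
  exact div_nonneg (mul_nonneg (by linarith) (by linarith)) (by linarith)

theorem setLIntegral_lintegral_enorm_heat1_le {t₁ t₂ s N : ℝ} (h1 : 0 < t₁) (h12 : t₁ ≤ t₂)
    (hN : 0 ≤ N) (hs : s ∈ Ioo 0 t₁) (y : ℝ) :
    ∫⁻ x₂ in Icc 0 N, ∫⁻ x₁ in Icc 0 N,
      ‖heat1 (2 * s * (2 * t₁ * t₂ / (t₁ + t₂) - s) / (2 * t₁ * t₂ / (t₁ + t₂)))
        ((s / (2 * t₁ * t₂ / (t₁ + t₂))) *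
          (2 * t₁ / (t₁ + t₂) * x₂ - 2 * t₂ / (t₁ + t₂) * x₁) - y)‖ₑ ≤
      ENNReal.ofReal (N * t₁) * ENNReal.ofReal s⁻¹ := by
  obtain ⟨hs0, hs1⟩ := hs
  have h2 : 0 < t₂ := by linarith
  have hτ : t₁ ≤ 2 * t₁ * t₂ / (t₁ + t₂) := by
    rw [le_div_iff₀ (by linarith)]; nlinarith
  have hv : 0 < 2 * s * (2 * t₁ * t₂ / (t₁ + t₂) - s) / (2 * t₁ * t₂ / (t₁ + t₂)) :=
    div_pos (mul_pos (by linarith) (by linarith)) (by linarith)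
  calc
    _ ≤ ∫⁻ x₂ in Icc 0 N, ENNReal.ofReal (t₁ * s⁻¹) := by
      refine lintegral_mono fun x₂ => (setLIntegral_le_lintegral _ _).trans ?_
      have key := lintegral_enorm_heat1_affine hv (b := s / t₁) (by positivity)
        (s / (2 * t₁ * t₂ / (t₁ + t₂)) * (2 * t₁ / (t₁ + t₂) * x₂) - y)
      rw [inv_div] at key
      rw [← div_eq_mul_inv, ← key]
      refine (lintegral_congr fun x₁ => ?_).le
      congr 2
      field_simp
      ring
    _ = _ := by
      rw [setLIntegral_const, Real.volume_Icc, sub_zero, ← ENNReal.ofReal_mul (by positivity),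
        ← ENNReal.ofReal_mul (by positivity)]
      congr 1
      ring

theorem setLIntegral_lintegral_enorm_heat1_le_of_le_half {t₁ t₂ s N : ℝ} (h1 : 0 < t₁)
    (h12 : t₁ ≤ t₂) (hN : 0 ≤ N) (hs0 : 0 < s) (hs : s ≤ t₁ / 2) (y : ℝ) :
    ∫⁻ x₂ in Icc 0 N, ∫⁻ x₁ in Icc 0 N,
      ‖heat1 (2 * s * (2 * t₁ * t₂ / (t₁ + t₂) - s) / (2 * t₁ * t₂ / (t₁ + t₂)))
        ((s / (2 * t₁ * t₂ / (t₁ + t₂))) *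
          (2 * t₁ / (t₁ + t₂) * x₂ - 2 * t₂ / (t₁ + t₂) * x₁) - y)‖ₑ ≤
      ENNReal.ofReal (N ^ 2) * ENNReal.ofReal (s ^ (-(1 : ℝ) / 2)) := by
  have hτ : t₁ ≤ 2 * t₁ * t₂ / (t₁ + t₂) := by
    rw [le_div_iff₀ (by linarith)]; nlinarith
  generalize 2 * t₁ * t₂ / (t₁ + t₂) = τ at *
  have hv : s ≤ 2 * s * (τ - s) / τ := by
    rw [le_div_iff₀ (by linarith)]; nlinarith
  calc
    _ ≤ ∫⁻ x₂ in Icc 0 N, ∫⁻ x₁ in Icc 0 N, ENNReal.ofReal (s ^ (-(1 : ℝ) / 2)) := by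
      gcongr with x₂ x₁
      rw [Real.enorm_of_nonneg (heat1_nonneg (hs0.le.trans hv) _)]
      exact ENNReal.ofReal_le_ofReal (heat1_le hs0 hv _)
    _ = _ := by
      rw [setLIntegral_const, setLIntegral_const, Real.volume_Icc, sub_zero, mul_assoc,
        ← ENNReal.ofReal_mul hN, mul_comm, sq]

theorem mul_VN_le (f : Measure ℝ) [IsFiniteMeasure f] {t₁ t₂ N : ℝ} (h1 : 0 < t₁)
    (h12 : t₁ ≤ t₂) (hN : 0 < N) (hNt : (N ^ 2)⁻¹ ≤ t₁ / 2) :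
    N * VN f t₁ t₂ N ≤ (2 + t₁ * Real.log (t₁ * N ^ 2)) * f.real univ := by
  have hε : 0 < (N ^ 2)⁻¹ := by positivity
  set F : ℝ → ℝ → ℝ → ℝ → ℝ := fun x₁ x₂ s y =>
    heat1 (2 * s * (2 * t₁ * t₂ / (t₁ + t₂) - s) / (2 * t₁ * t₂ / (t₁ + t₂)))
        ((s / (2 * t₁ * t₂ / (t₁ + t₂))) *
          (2 * t₁ / (t₁ + t₂) * x₂ - 2 * t₂ / (t₁ + t₂) * x₁) - y) with hF
  have hFm : Measurable fun p : ℝ × ℝ × ℝ × ℝ => ‖F p.1 p.2.1 p.2.2.1 p.2.2.2‖ₑ := by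
    simp only [hF, heat1]
    fun_prop
  set J : ℝ := ∫ x₁ in Icc (0 : ℝ) N, ∫ x₂ in Icc (0 : ℝ) N,
    ∫ s in Ioo (0 : ℝ) t₁, ∫ y, F x₁ x₂ s y ∂f
  have hV : N * VN f t₁ t₂ N = N⁻¹ * J := by
    change N * ((N ^ 2)⁻¹ * J) = _
    field_simp
  have hlog : 0 ≤ Real.log (t₁ * N ^ 2) := by
    refine Real.log_nonneg ?_
    rw [inv_le_iff_one_le_mul₀ (by positivity)] at hNt
    nlinarith [mul_pos h1 (pow_pos hN 2)]
  have hJ1 : ‖J‖ₑ ≤ ∫⁻ s in Ioo 0 t₁, ∫⁻ y, (∫⁻ x₂ in Icc 0 N, ∫⁻ x₁ in Icc 0 N,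
      ‖F x₁ x₂ s y‖ₑ) ∂f := by
    rw [← lintegral_lintegral_lintegral_lintegral_swap _ _ _ _
      (fun x₁ x₂ s y => ‖F x₁ x₂ s y‖ₑ) hFm]
    refine (enorm_integral_le_lintegral_enorm _).trans (lintegral_mono fun x₁ => ?_)
    refine (enorm_integral_le_lintegral_enorm _).trans (lintegral_mono fun x₂ => ?_)
    refine (enorm_integral_le_lintegral_enorm _).trans (lintegral_mono fun s => ?_)
    exact enorm_integral_le_lintegral_enorm _
  have hconst (c : ENNReal) (g : ℝ → ENNReal) (hg : ∀ y, g y ≤ c) :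
      ∫⁻ y, g y ∂f ≤ f univ * c :=
    (lintegral_mono hg).trans (by rw [lintegral_const, mul_comm])
  have hsub : Ioo 0 t₁ ⊆ Ioc 0 (N ^ 2)⁻¹ ∪ Ioo (N ^ 2)⁻¹ t₁ := fun s hs =>
    (le_or_gt s (N ^ 2)⁻¹).imp (fun h => ⟨hs.1, h⟩) fun h => ⟨h, hs.2⟩
  have hJ2 : ‖J‖ₑ ≤ f univ * ENNReal.ofReal (N * (2 + t₁ * Real.log (t₁ * N ^ 2))) := by
    refine hJ1.trans ((lintegral_mono_set hsub).trans ((lintegral_union_le _ _ _).trans ?_))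
    calc
      _ ≤ (∫⁻ s in Ioc 0 (N ^ 2)⁻¹, f univ *
            (ENNReal.ofReal (N ^ 2) * ENNReal.ofReal (s ^ (-(1 : ℝ) / 2)))) +
          ∫⁻ s in Ioo (N ^ 2)⁻¹ t₁, f univ *
            (ENNReal.ofReal (N * t₁) * ENNReal.ofReal s⁻¹) := by
        refine add_le_add (setLIntegral_mono' measurableSet_Ioc fun s hs => ?_)
          (setLIntegral_mono' measurableSet_Ioo fun s hs => ?_)
        · exact hconst _ _ fun y => setLIntegral_lintegral_enorm_heat1_le_of_le_half h1 h12 hN.le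
            hs.1 (hs.2.trans hNt) y
        · exact hconst _ _ fun y => setLIntegral_lintegral_enorm_heat1_le h1 h12 hN.le
            ⟨hε.trans hs.1, hs.2⟩ y
      _ = f univ * (ENNReal.ofReal (N ^ 2) * ENNReal.ofReal (2 * √(N ^ 2)⁻¹)) +
          f univ * (ENNReal.ofReal (N * t₁) * ENNReal.ofReal (Real.log (t₁ / (N ^ 2)⁻¹))) := by
        rw [setLIntegral_congr Ioo_ae_eq_Ioc, lintegral_const_mul _ (by fun_prop),
          lintegral_const_mul _ (by fun_prop), lintegral_const_mul _ (by fun_prop),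
          lintegral_const_mul _ (by fun_prop), setLIntegral_rpow_neg_half hε,
          setLIntegral_inv hε (by linarith)]
      _ = _ := by
        rw [div_inv_eq_mul, Real.sqrt_inv, Real.sqrt_sq hN.le, ← mul_add,
          ← ENNReal.ofReal_mul (by positivity), ← ENNReal.ofReal_mul (by positivity),
          ← ENNReal.ofReal_add (by positivity) (by positivity)]
        congr 2
        field_simp
  have hJ3 : J ≤ f.real univ * (N * (2 + t₁ * Real.log (t₁ * N ^ 2))) := by
    have h := ENNReal.toReal_mono (by finiteness) hJ2
    rw [toReal_enorm, ENNReal.toReal_mul, ENNReal.toReal_ofReal (by positivity)] at h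
    exact (le_abs_self J).trans h
  rw [hV, inv_mul_le_iff₀ hN]
  linarith

/-- For a finite nonnegative Borel measure `f` on `ℝ` and `0 < t₁ ≤ t₂`,
`limsup_{N→∞} (N / log N) V_N ≤ 2 t₁ f(ℝ)`. -/
theorem stmt_10 (f : Measure ℝ) [IsFiniteMeasure f] (t₁ t₂ : ℝ)
    (h1 : 0 < t₁) (h12 : t₁ ≤ t₂) :
    Filter.limsup (fun N : ℝ => (N / Real.log N) * VN f t₁ t₂ N) Filter.atTop ≤
      2 * t₁ * (f Set.univ).toReal := by
  have hlim : Tendsto (fun N : ℝ => ((2 + t₁ * Real.log t₁) * (Real.log N)⁻¹ + 2 * t₁) *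
      f.real univ) atTop (nhds (2 * t₁ * f.real univ)) := by
    have h := ((Real.tendsto_log_atTop.inv_tendsto_atTop.const_mul
      (2 + t₁ * Real.log t₁)).add_const (2 * t₁)).mul_const (f.real univ)
    simpa using h
  have hsmall : ∀ᶠ N : ℝ in atTop, (N ^ 2)⁻¹ ≤ t₁ / 2 :=
    (tendsto_pow_atTop two_ne_zero).inv_tendsto_atTop.eventually_le_const (by positivity)
  refine (limsup_le_limsup ?_ ?_ hlim.isBoundedUnder_le).trans hlim.limsup_eq.le
  · filter_upwards [hsmall, eventually_gt_atTop 1] with N hN hN1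
    have hlog : 0 < Real.log N := Real.log_pos hN1
    have h := mul_VN_le f h1 h12 (by linarith) hN
    rw [Real.log_mul h1.ne' (by positivity), Real.log_pow] at h
    rw [div_mul_eq_mul_div, div_le_iff₀ hlog]
    refine h.trans (le_of_eq ?_)
    push_cast
    field_simp
    ring
  · refine IsCoboundedUnder.of_frequently_ge (a := 0) (Eventually.frequently ?_)
    filter_upwards [eventually_gt_atTop 1] with N hN1
    exact mul_nonneg (div_nonneg (by linarith) (Real.log_pos hN1).le) (VN_nonneg f h1 h12 N)
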